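/- arXiv:2301.12329 — 11 statements merged into one kernel-verified Lean document; each statement's English description precedes it below -/
import Mathlib

section
/- Let ≽ be a binary relation on ℝ^n with n ≥ 1 and let x ∈ ℝ^n. If the strict upper contour set Uˢ(x) is a convex set, then N(x) contains a nonzero element, i.e. N(x) \ {0} ≠ ∅. -/
open RealInnerProductSpace

noncomputable section

/-- Euclidean space ℝ^n. -/
abbrev Euc (n : ℕ) := EuclideanSpace ℝ (Fin n)

/-- The asymmetric (strict) part of the binary relation `R`: `x ≻ y`. -/
def SP {n : ℕ} (R : Euc n → Euc n → Prop) (x y : Euc n) : Prop := R x y ∧ ¬ R y x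

/-- The strict upper contour set `Uˢ(x) = {y : y ≻ x}`. -/
def Us {n : ℕ} (R : Euc n → Euc n → Prop) (x : Euc n) : Set (Euc n) := {y | SP R y x}

/-- The strict lower contour set `Lˢ(x) = {y : x ≻ y}`. -/
def Ls {n : ℕ} (R : Euc n → Euc n → Prop) (x : Euc n) : Set (Euc n) := {y | SP R x y}

/-- The normal cone `𝒩_A(x)`.  Note that when `A = ∅` this set is (vacuously) all of `ℝ^n`,
as in the definition in the paper. -/
def nCone {n : ℕ} (A : Set (Euc n)) (x : Euc n) : Set (Euc n) :=
  {p | ∀ y ∈ A, ⟪p, y - x⟫ ≤ 0}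

/-- The normal cone correspondence `N(x) = 𝒩_{Uˢ(x)}(x)` associated to `R`. -/
def N {n : ℕ} (R : Euc n → Euc n → Prop) (x : Euc n) : Set (Euc n) := nCone (Us R x) x

/-- `N*(x)`: strict version of the normal cone.  When `Uˢ(x) = ∅` this set is
(vacuously) all of `ℝ^n`, as in the definition in the paper. -/
def Nstar {n : ℕ} (R : Euc n → Euc n → Prop) (x : Euc n) : Set (Euc n) :=
  {p | ∀ y ∈ Us R x, ⟪p, y - x⟫ < 0}

/-- In a nontrivial finite-dimensional real inner product space, a convex set and a point outside
it are weakly separated by a hyperplane through the point. -/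
theorem Convex.exists_ne_zero_forall_inner_sub_nonpos {E : Type*} [NormedAddCommGroup E]
    [InnerProductSpace ℝ E] [FiniteDimensional ℝ E] [Nontrivial E] {s : Set E}
    (hs : Convex ℝ s) {x : E} (hx : x ∉ s) :
    ∃ p : E, p ≠ 0 ∧ ∀ y ∈ s, ⟪p, y - x⟫ ≤ 0 := by
  rcases s.eq_empty_or_nonempty with rfl | ⟨a, ha⟩
  · obtain ⟨p, hp⟩ := exists_ne (0 : E)
    exact ⟨p, hp, by simp⟩
  by_cases hint : (interior s).Nonempty
  · obtain ⟨f, hf, hfs⟩ := geometric_hahn_banach_of_nonempty_interior_point hs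
      (fun h => hx (interior_subset h)) hint
    refine ⟨(InnerProductSpace.toDual ℝ E).symm f, by simpa using hf, fun y hy => ?_⟩
    simpa using hfs y hy
  · rw [hs.interior_nonempty_iff_affineSpan_eq_top] at hint
    have hdir : (affineSpan ℝ s).direction ≠ ⊤ := fun h => hint <|
      (AffineSubspace.direction_eq_top_iff_of_nonempty ⟨a, subset_affineSpan ℝ s ha⟩).1 h
    obtain ⟨p, hp, hp0⟩ := Submodule.exists_mem_ne_zero_of_ne_bot
      (mt Submodule.orthogonal_eq_bot_iff.1 hdir)
    have hconst : ∀ y ∈ s, ⟪p, y - x⟫ = ⟪p, a - x⟫ := fun y hy => by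
      have h := Submodule.inner_left_of_mem_orthogonal (AffineSubspace.vsub_mem_direction
        (subset_affineSpan ℝ s hy) (subset_affineSpan ℝ s ha)) hp
      rw [vsub_eq_sub, ← sub_sub_sub_cancel_right y a x, inner_sub_right] at h
      exact sub_eq_zero.1 h
    rcases le_total ⟪p, a - x⟫ 0 with h | h
    · exact ⟨p, hp0, fun y hy => (hconst y hy).trans_le h⟩
    · exact ⟨-p, neg_ne_zero.2 hp0, fun y hy => by
        rwa [inner_neg_left, hconst y hy, neg_nonpos]⟩

/-- If `n ≥ 1` and the strict upper contour set `Uˢ(x)` is convex,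
then `N(x)` contains a nonzero element. -/
theorem stmt_3 {n : ℕ} (hn : 1 ≤ n) (R : Euc n → Euc n → Prop) (x : Euc n)
    (hconv : Convex ℝ (Us R x)) :
    ∃ p ∈ N R x, p ≠ 0 := by
  have : NeZero n := ⟨by omega⟩
  have hx : x ∉ Us R x := fun h => h.2 h.1
  obtain ⟨p, hp0, hp⟩ := hconv.exists_ne_zero_forall_inner_sub_nonpos hx
  exact ⟨p, hp, hp0⟩
end
end

section
/- Let ≽ be a binary relation on ℝ^n. If ≽ is upper semicontinuous, then the normal cone correspondence N is closed, i.e. its graph {(x, x*) ∈ ℝ^n × ℝ^n : x* ∈ N(x)} is a closed subset of ℝ^n × ℝ^n. -/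
open RealInnerProductSpace

noncomputable section

/-- If `R` is upper semicontinuous (every strict lower contour set is open),
then the normal cone correspondence `N` is closed: its graph is closed in `ℝ^n × ℝ^n`. -/
theorem stmt_4 {n : ℕ} (R : Euc n → Euc n → Prop)
    (husc : ∀ x : Euc n, IsOpen (Ls R x)) :
    IsClosed {p : Euc n × Euc n | p.2 ∈ N R p.1} := by
  have h : {p : Euc n × Euc n | p.2 ∈ N R p.1} =
      ⋂ y, {p | p.1 ∈ Ls R y → ⟪p.2, y - p.1⟫ ≤ 0} := by
    ext p
    simp [N, nCone, Us, Ls]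
  rw [h]
  exact isClosed_iInter fun y => isClosed_imp ((husc y).preimage continuous_fst)
    (isClosed_le (by fun_prop) continuous_const)
end
end

section
/- Let ≽ be a rational (complete and transitive) binary relation on ℝ^n. If N*(x) ≠ ∅ for all x ∈ ℝ^n, then ≽ is convex, i.e. the upper contour set U(x) = {y ∈ ℝ^n : y ≽ x} is convex for all x ∈ ℝ^n. -/
open RealInnerProductSpace

noncomputable section

/-- Let `R` be a rational (complete and transitive) relation on `ℝ^n`.
If `N*(x) ≠ ∅` for all `x`, then `R` is convex: every upper contour set
`U(x) = {y : y ≽ x}` is convex. -/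
theorem stmt_5 {n : ℕ} (R : Euc n → Euc n → Prop)
    (hcomp : ∀ x y : Euc n, R x y ∨ R y x)
    (htrans : ∀ x y z : Euc n, R x y → R y z → R x z)
    (hNs : ∀ x : Euc n, (Nstar R x).Nonempty) :
    ∀ x : Euc n, Convex ℝ {y | R y x} := by
  intro x a ha b hb s t hs ht hst
  by_contra hz
  set z := s • a + t • b
  have hxz : R x z := (hcomp x z).resolve_right hz
  have upper_mem : ∀ y, R y x → y ∈ Us R z := fun y hy =>
    ⟨htrans _ _ _ hy hxz, fun hzy => hz (htrans _ _ _ hzy hy)⟩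
  obtain ⟨p, hp⟩ := hNs z
  have lt_of_upper : ∀ y, R y x → ⟪p, y⟫ < ⟪p, z⟫ := fun y hy => by
    simpa [inner_sub_right] using hp y (upper_mem y hy)
  have hconv : Convex ℝ {y : Euc n | ⟪p, y⟫ < ⟪p, z⟫} :=
    convex_halfSpace_lt (innerₛₗ ℝ p).isLinear _
  exact lt_irrefl ⟪p, z⟫ (hconv (lt_of_upper a ha) (lt_of_upper b hb) hs ht hst)
end
end

section
/- Let ≽ be a lower semicontinuous binary relation on ℝ^n. Then N(x) = N*(x) ∪ {0} for all x ∈ ℝ^n. -/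
open RealInnerProductSpace

noncomputable section

/-- A nonzero vector in the normal cone of an open set at `x` is strictly normal to it. -/
theorem inner_sub_neg_of_mem_nCone {n : ℕ} {A : Set (Euc n)} (hA : IsOpen A) {x p y : Euc n}
    (hp : p ∈ nCone A x) (hp0 : p ≠ 0) (hy : y ∈ A) : ⟪p, y - x⟫ < 0 := by
  have hcont : Continuous fun t : ℝ => y + t • p := by fun_prop
  have hnear : ∀ᶠ t : ℝ in nhds 0, y + t • p ∈ A :=
    hcont.continuousAt.eventually (hA.mem_nhds (by simpa using hy))
  obtain ⟨t, htA, ht⟩ :=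
    ((hnear.filter_mono nhdsWithin_le_nhds).and
      (self_mem_nhdsWithin : Set.Ioi (0 : ℝ) ∈ nhdsWithin 0 (Set.Ioi 0))).exists
  have hle : ⟪p, y + t • p - x⟫ ≤ 0 := hp _ htA
  rw [add_sub_right_comm, inner_add_right, real_inner_smul_right] at hle
  have hpos : 0 < t * ⟪p, p⟫ := mul_pos ht (real_inner_self_pos.2 hp0)
  linarith

/-- If `R` is lower semicontinuous (every strict upper contour set is open),
then `N(x) = N*(x) ∪ {0}` for all `x ∈ ℝ^n`. -/
theorem stmt_6 {n : ℕ} (R : Euc n → Euc n → Prop)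
    (hlsc : ∀ x : Euc n, IsOpen (Us R x)) :
    ∀ x : Euc n, N R x = Nstar R x ∪ {0} := by
  intro x
  ext p
  constructor
  · intro hp
    by_cases hp0 : p = 0
    · exact Or.inr hp0
    · exact Or.inl fun y hy => inner_sub_neg_of_mem_nCone (hlsc x) hp hp0 hy
  · rintro (hp | rfl) y hy
    · exact (hp y hy).le
    · exact (inner_zero_left _).le
end
end

section
/- Let ≽ be a lower semicontinuous binary relation on ℝ^n with n ≥ 1. If, in addition, ≽ is convexˢ (Uˢ(x) is convex for all x), then N*(x) ≠ ∅ for all x ∈ ℝ^n. -/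
open RealInnerProductSpace

noncomputable section

/-- Let `n ≥ 1` and `R` be lower semicontinuous.  If in addition `R` is
convexˢ (every strict upper contour set is convex), then `N*(x) ≠ ∅` for all `x`. -/
theorem stmt_7 {n : ℕ} (hn : 1 ≤ n) (R : Euc n → Euc n → Prop)
    (hlsc : ∀ x : Euc n, IsOpen (Us R x))
    (hconv : ∀ x : Euc n, Convex ℝ (Us R x)) :
    ∀ x : Euc n, (Nstar R x).Nonempty := by
  intro x
  have hx : x ∉ Us R x := fun h => h.2 h.1
  obtain ⟨f, hf⟩ := geometric_hahn_banach_open_point (hconv x) (hlsc x) hx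
  refine ⟨(InnerProductSpace.toDual ℝ (Euc n)).symm f, fun y hy => ?_⟩
  rw [InnerProductSpace.toDual_symm_apply, map_sub]
  exact sub_neg.mpr (hf y hy)
end
end

section
/- Let ≽ be a binary relation on ℝ^n with n ≥ 1 and let T(x) = conv(N(x) ∩ S[0,1]). If ≽ is convexˢ and lower semicontinuous, then T(x) ≠ ∅ for all x ∈ ℝ^n. -/
open RealInnerProductSpace

noncomputable section

/-- The correspondence `T(x) = conv(N(x) ∩ S[0,1])`, where `S[0,1]` is the unit sphere. -/
def T {n : ℕ} (R : Euc n → Euc n → Prop) (x : Euc n) : Set (Euc n) :=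
  convexHull ℝ (N R x ∩ Metric.sphere (0 : Euc n) 1)

/-- An open convex set in `ℝ^n`, `n ≥ 1`, has a unit normal vector at each point outside it. -/
theorem exists_unit_mem_nCone {n : ℕ} (hn : 1 ≤ n) {A : Set (Euc n)} (hA : Convex ℝ A)
    (hA' : IsOpen A) {x : Euc n} (hx : x ∉ A) : ∃ p ∈ nCone A x, ‖p‖ = 1 := by
  rcases A.eq_empty_or_nonempty with rfl | ⟨y, hy⟩
  · exact ⟨EuclideanSpace.single ⟨0, hn⟩ 1, by simp [nCone], by simp⟩
  · obtain ⟨f, hf⟩ := geometric_hahn_banach_open_point hA hA' hx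
    have hne : f ≠ 0 := fun h => by simpa [h] using hf y hy
    set p := (InnerProductSpace.toDual ℝ (Euc n)).symm f with hp
    have hp0 : p ≠ 0 := by simpa [hp] using hne
    refine ⟨‖p‖⁻¹ • p, fun z hz => ?_, norm_smul_inv_norm (𝕜 := ℝ) hp0⟩
    have hz' : ⟪p, z - x⟫ ≤ 0 := by
      rw [hp, InnerProductSpace.toDual_symm_apply, map_sub]
      exact sub_nonpos.mpr (hf z hz).le
    rw [real_inner_smul_left]
    exact mul_nonpos_of_nonneg_of_nonpos (by positivity) hz'

/-- Let `n ≥ 1`.  If `R` is convexˢ and lower semicontinuous,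
then `T(x) ≠ ∅` for all `x ∈ ℝ^n`. -/
theorem stmt_9 {n : ℕ} (hn : 1 ≤ n) (R : Euc n → Euc n → Prop)
    (hconv : ∀ x : Euc n, Convex ℝ (Us R x))
    (hlsc : ∀ x : Euc n, IsOpen (Us R x)) :
    ∀ x : Euc n, (T R x).Nonempty := by
  intro x
  obtain ⟨p, hp, hp1⟩ := exists_unit_mem_nCone hn (hconv x) (hlsc x)
    (fun h : SP R x x => h.2 h.1)
  exact ⟨p, subset_convexHull ℝ _ ⟨hp, by simpa using hp1⟩⟩
end
end

section
/- Let X be a convex, compact, non-empty subset of ℝ^n (n ≥ 1) and let ≽ be a binary relation on ℝ^n. If ≽ is continuous (both upper and lower semicontinuous) and convexˢ, then there exists at least one maximal element of ≽ on X, i.e. there exists x̂ ∈ X with Uˢ(x̂) ∩ X = ∅. -/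
open RealInnerProductSpace

noncomputable section

/-- A finite set `B` is dominant for a family of rankings `r` if no point lies strictly above
`B` in every ranking. -/
def IsDominant {S I α : Type*} [LinearOrder α] (r : I → S → α) (B : Finset S) : Prop :=
  ∀ y, ∃ i, ∀ x ∈ B, r i y ≤ r i x

/-- A set that is not rainbow but has a facet with colour set `univ.erase i₀` has exactly two
such facets. -/
theorem exists_pair_facets {S I : Type*} [Fintype I] [DecidableEq S] [DecidableEq I]
    {c : S → I} {i₀ : I} {D : Finset S} {v : S} (hv : v ∉ D)
    (hcard : D.card + 1 = Fintype.card I) (hD : D.image c = Finset.univ.erase i₀)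
    (hB : (insert v D).image c ≠ Finset.univ) :
    ∃ w ∈ D, ∀ u ∈ insert v D,
      ((insert v D).erase u).image c = Finset.univ.erase i₀ ↔ u = v ∨ u = w := by
  have hcv : c v ≠ i₀ := by
    rintro rfl
    exact hB (by rw [Finset.image_insert, hD, Finset.insert_erase (Finset.mem_univ _)])
  have hmem : c v ∈ D.image c := by rw [hD]; simp [hcv]
  obtain ⟨w, hw, hwv⟩ := Finset.mem_image.1 hmem
  have hvw : v ≠ w := fun h => hv (h ▸ hw)
  refine ⟨w, hw, fun u hu => ⟨fun h => ?_, ?_⟩⟩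
  · by_contra! hne
    have hinj : Set.InjOn c ((insert v D).erase u : Finset S) := by
      apply Finset.injOn_of_card_image_eq
      rw [h, Finset.card_erase_of_mem hu, Finset.card_insert_of_notMem hv,
        Finset.card_erase_of_mem (Finset.mem_univ _), Finset.card_univ]
      omega
    exact hvw (hinj (by simp [hne.1.symm]) (by simp [hne.2.symm, hw]) hwv.symm)
  · rintro (rfl | rfl)
    · rw [Finset.erase_insert hv, hD]
    · rw [← hD]
      ext j
      simp only [Finset.mem_image, Finset.mem_erase, Finset.mem_insert]
      constructor
      · rintro ⟨x, ⟨hx, rfl | hx'⟩, rfl⟩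
        · exact ⟨u, hw, hwv⟩
        · exact ⟨x, hx', rfl⟩
      · rintro ⟨x, hx, rfl⟩
        by_cases hxu : x = u
        · exact ⟨v, ⟨hvw, Or.inl rfl⟩, by rw [hxu, hwv]⟩
        · exact ⟨x, ⟨hxu, Or.inr hx⟩, rfl⟩

/-- A dominant set with one element fewer than there are rankings extends to a dominant set in
exactly two ways, provided each ranking `p` has a point above its minimum in all rankings but
`p`. -/
theorem IsDominant.exists_pair_insert {S I α : Type*} [Fintype S] [Fintype I] [DecidableEq S]
    [DecidableEq I] [LinearOrder α] {r : I → S → α} (hr : ∀ i, Function.Injective (r i))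
    {D : Finset S} (hD : IsDominant r D) (hcard : D.card + 1 = Fintype.card I)
    (hne : D.Nonempty) (hup : ∀ p, ∃ y, ∀ j ≠ p, ∃ z ∈ D, r j z < r j y) :
    ∃ x₁ x₂, x₁ ≠ x₂ ∧ ∀ x, (x ∉ D ∧ IsDominant r (insert x D)) ↔ x = x₁ ∨ x = x₂ := by
  have hmin : ∀ i, ∃ m ∈ D, ∀ x ∈ D, r i m ≤ r i x := fun i => D.exists_min_image (r i) hne
  choose m hmD hm using hmin
  have hsurj : ∀ x ∈ D, ∃ i, m i = x := fun x hx => by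
    obtain ⟨i, hi⟩ := hD x
    exact ⟨i, hr i (le_antisymm (hm i x hx) (hi _ (hmD i)))⟩
  obtain ⟨a, -, b, -, hab, hmab⟩ : ∃ a ∈ Finset.univ, ∃ b ∈ Finset.univ, a ≠ b ∧ m a = m b :=
    Finset.exists_ne_map_eq_of_card_lt_of_maps_to (t := D)
      (by rw [Finset.card_univ]; omega) (fun i _ => hmD i)
  have hsurj' : ∀ p, p = a ∨ p = b → ∀ x ∈ D, ∃ j, j ≠ p ∧ m j = x := by
    intro p hp x hx
    obtain ⟨i, rfl⟩ := hsurj x hx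
    by_cases hip : i = p
    · subst hip
      rcases hp with rfl | rfl
      · exact ⟨b, hab.symm, hmab.symm⟩
      · exact ⟨a, hab, hmab⟩
    · exact ⟨i, hip, rfl⟩
  let M : I → Set S := fun p => {y | ∀ j ≠ p, r j (m j) < r j y}
  have hMmax : ∀ p, ∃ x ∈ M p, ∀ y ∈ M p, r p y ≤ r p x := by
    intro p
    obtain ⟨y, hy⟩ := hup p
    have hyM : y ∈ M p := fun j hj => by
      obtain ⟨z, hz, hzy⟩ := hy j hj
      exact (hm j z hz).trans_lt hzy
    exact (Set.toFinite (M p)).exists_maximalFor (r p) _ ⟨y, hyM⟩ |>.elim fun x hx =>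
      ⟨x, hx.1, fun y hy => (le_total (r p y) (r p x)).elim id (fun h => hx.2 hy h)⟩
  choose X hXM hXmax using hMmax
  have hdisj : ∀ x, x ∈ M a → x ∉ M b := by
    intro x ha hb
    obtain ⟨i, hi⟩ := hD x
    by_cases hia : i = a
    · exact absurd (hi _ (hmD i)) (not_le.2 (hb i (hia ▸ hab)))
    · exact absurd (hi _ (hmD i)) (not_le.2 (ha i hia))
  have hback : ∀ p, p = a ∨ p = b → X p ∉ D ∧ IsDominant r (insert (X p) D) := by
    intro p hp
    refine ⟨fun hmem => ?_, fun y => ?_⟩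
    · obtain ⟨j, hjp, hj⟩ := hsurj' p hp _ hmem
      exact lt_irrefl _ (hj ▸ hXM p j hjp)
    · by_cases hy : y ∈ M p
      · refine ⟨p, fun x hx => ?_⟩
        rcases Finset.mem_insert.1 hx with rfl | hxD
        · exact hXmax p y hy
        · obtain ⟨i, hi⟩ := hD (X p)
          have hip : i = p := by
            by_contra hip
            exact absurd (hi _ (hmD i)) (not_le.2 (hXM p i hip))
          subst hip
          exact (hXmax i y hy).trans (hi x hxD)
      · obtain ⟨j, hjp, hj⟩ : ∃ j, j ≠ p ∧ r j y ≤ r j (m j) := by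
          simpa [M] using hy
        refine ⟨j, fun x hx => ?_⟩
        rcases Finset.mem_insert.1 hx with rfl | hx
        · exact hj.trans (hXM p j hjp).le
        · exact hj.trans (hm j x hx)
  refine ⟨X a, X b, fun h => hdisj _ (hXM a) (h ▸ hXM b), fun x => ⟨?_, ?_⟩⟩
  · rintro ⟨hxD, hx⟩
    obtain ⟨p, hp⟩ := hx x
    let J : Finset I := (Finset.univ.erase p).filter fun j => r j (m j) < r j x
    have hJimg : D ⊆ J.image m := by
      intro z hz
      obtain ⟨j, hj⟩ := hx z
      have hmj : m j = z :=
        hr j (le_antisymm (hm j z hz) (hj _ (Finset.mem_insert_of_mem (hmD j))))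
      have hzx : z ≠ x := fun h => hxD (h ▸ hz)
      have hlt : r j z < r j x :=
        lt_of_le_of_ne (hj x (Finset.mem_insert_self _ _)) fun h => hzx (hr j h)
      refine Finset.mem_image.2 ⟨j, ?_, hmj⟩
      simp only [J, Finset.mem_filter, Finset.mem_erase, Finset.mem_univ, and_true]
      refine ⟨?_, hmj ▸ hlt⟩
      rintro rfl
      exact absurd (hp z (Finset.mem_insert_of_mem hz)) (not_le.2 hlt)
    have hJ : J = Finset.univ.erase p := by
      apply Finset.eq_of_subset_of_card_le (Finset.filter_subset _ _)
      rw [Finset.card_erase_of_mem (Finset.mem_univ _), Finset.card_univ]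
      have : D.card ≤ J.card := (Finset.card_le_card hJimg).trans Finset.card_image_le
      have hJc : Fintype.card I - 1 ≤ J.card := by omega
      exact hJc
    have hxM : x ∈ M p := fun j hj => by
      have : j ∈ J := by rw [hJ]; simp [hj]
      exact (Finset.mem_filter.1 this).2
    have hinj : Set.InjOn m (Finset.univ.erase p : Finset I) := by
      apply Finset.injOn_of_card_image_eq
      apply le_antisymm Finset.card_image_le
      rw [Finset.card_erase_of_mem (Finset.mem_univ _), Finset.card_univ]
      have := Finset.card_le_card hJimg
      rw [hJ] at this
      omega
    have hpab : p = a ∨ p = b := by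
      by_contra! h
      exact hab (hinj (by simp [h.1.symm]) (by simp [h.2.symm]) hmab)
    have hxX : x = X p := by
      obtain ⟨j, hj⟩ := hx (X p)
      have hjp : j = p := by
        by_contra hjp
        exact absurd (hj _ (Finset.mem_insert_of_mem (hmD j))) (not_le.2 (hXM p j hjp))
      subst hjp
      exact hr j (le_antisymm (hXmax j x hxM) (hj x (Finset.mem_insert_self _ _)))
    rcases hpab with rfl | rfl
    · exact Or.inl hxX
    · exact Or.inr hxX
  · rintro (rfl | rfl)
    · exact hback a (Or.inl rfl)
    · exact hback b (Or.inr rfl)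

/-- The dominant supersets of `D` with one more element correspond to the dominant one-point
extensions of `D`. -/
theorem card_dominant_supersets {S I α : Type*} [Fintype S] [DecidableEq S] [LinearOrder α]
    (r : I → S → α) (D : Finset S)
    [DecidablePred (IsDominant r)] :
    (Finset.univ.filter fun B : Finset S =>
      (IsDominant r B ∧ B.card = D.card + 1) ∧ D ⊆ B).card =
    (Finset.univ.filter fun x => x ∉ D ∧ IsDominant r (insert x D)).card := by
  symm
  refine Finset.card_bij (fun x _ => insert x D) ?_ ?_ ?_
  · intro x hx
    simp only [Finset.mem_filter, Finset.mem_univ, true_and] at hx ⊢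
    exact ⟨⟨hx.2, Finset.card_insert_of_notMem hx.1⟩, Finset.subset_insert _ _⟩
  · intro x hx y hy h
    simp only [Finset.mem_filter, Finset.mem_univ, true_and] at hx hy
    have : x ∈ insert y D := h ▸ Finset.mem_insert_self x D
    exact (Finset.mem_insert.1 this).resolve_right hx.1
  · intro B hB
    simp only [Finset.mem_filter, Finset.mem_univ, true_and] at hB
    obtain ⟨x, hx, rfl⟩ := (Finset.covBy_iff_exists_insert.1
      (Finset.covBy_iff_card_sdiff_eq_one.2 ⟨hB.2, by
        rw [Finset.card_sdiff_of_subset hB.2]; omega⟩))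
    exact ⟨x, by simpa using ⟨hx, hB.1.1⟩, rfl⟩

/-- **Scarf's lemma** for a family of rankings with slack points `s i`: every colouring which is
the identity on slack points admits a dominant rainbow set. -/
theorem exists_dominant_rainbow {S I α : Type*} [Fintype S] [Fintype I] [LinearOrder α]
    [DecidableEq I] {r : I → S → α} (hr : ∀ i, Function.Injective (r i))
    {s : I → S} (hs : ∀ i x, x ≠ s i → r i (s i) < r i x)
    (hs' : ∀ i j x, j ≠ i → x ∉ Set.range s → r i x < r i (s j))
    (hT : ∃ t, t ∉ Set.range s) [Nonempty I] {c : S → I} (hc : ∀ i, c (s i) = i) :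
    ∃ B : Finset S, IsDominant r B ∧ B.image c = Finset.univ ∧ B.card = Fintype.card I := by
  classical
  by_contra! hno
  obtain ⟨i₀⟩ := ‹Nonempty I›
  have hsinj : Function.Injective s := Function.LeftInverse.injective hc
  let doors : Finset (Finset S) := Finset.univ.filter fun D =>
    IsDominant r D ∧ D.card + 1 = Fintype.card I ∧ D.image c = Finset.univ.erase i₀
  let rooms : Finset (Finset S) := Finset.univ.filter fun B =>
    IsDominant r B ∧ B.card = Fintype.card I
  let D₀ : Finset S := (Finset.univ.erase i₀).image s
  have hcardI : (Finset.univ.erase i₀).card + 1 = Fintype.card I := by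
    rw [Finset.card_erase_add_one (Finset.mem_univ _), Finset.card_univ]
  have hD₀card : D₀.card + 1 = Fintype.card I := by
    rw [Finset.card_image_of_injective _ hsinj, hcardI]
  have hD₀ : D₀ ∈ doors := by
    simp only [doors, Finset.mem_filter, Finset.mem_univ, true_and]
    refine ⟨fun y => ?_, hD₀card, ?_⟩
    · by_cases hy : y ∈ Set.range s
      · obtain ⟨j, rfl⟩ := hy
        refine ⟨j, fun x _ => ?_⟩
        by_cases hx : x = s j
        · rw [hx]
        · exact (hs j x hx).le
      · refine ⟨i₀, fun x hx => ?_⟩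
        obtain ⟨j, hj, rfl⟩ := Finset.mem_image.1 hx
        exact (hs' i₀ j y (Finset.ne_of_mem_erase hj) hy).le
    · ext j
      simp [D₀, hc]
  have hroom : ∀ B ∈ rooms, Even (doors.filter fun D => D ⊆ B).card := by
    intro B hB
    simp only [rooms, Finset.mem_filter, Finset.mem_univ, true_and] at hB
    rcases Finset.eq_empty_or_nonempty (doors.filter fun D => D ⊆ B) with h | ⟨D, hD⟩
    · simp [h]
    simp only [doors, Finset.mem_filter, Finset.mem_univ, true_and] at hD
    obtain ⟨⟨hDd, hDc, hDi⟩, hDB⟩ := hD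
    obtain ⟨v, hv, rfl⟩ := (Finset.covBy_iff_exists_insert.1
      (Finset.covBy_iff_card_sdiff_eq_one.2 ⟨hDB, by
        rw [Finset.card_sdiff_of_subset hDB]; omega⟩))
    obtain ⟨w, hw, hwu⟩ := exists_pair_facets hv hDc hDi fun h => hno _ hB.1 h hB.2
    have hvw : v ≠ w := fun h => hv (h ▸ hw)
    have : (doors.filter fun D' => D' ⊆ insert v D) =
        {(insert v D).erase v, (insert v D).erase w} := by
      ext D'
      simp only [doors, Finset.mem_filter, Finset.mem_univ, true_and, Finset.mem_insert,
        Finset.mem_singleton]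
      constructor
      · rintro ⟨⟨h1, h2, h3⟩, h4⟩
        obtain ⟨u, hu, hu'⟩ := (Finset.covBy_iff_exists_insert.1
          (Finset.covBy_iff_card_sdiff_eq_one.2 ⟨h4, by
            rw [Finset.card_sdiff_of_subset h4]; omega⟩))
        have hD' : D' = (insert v D).erase u := by rw [← hu', Finset.erase_insert hu]
        have humem : u ∈ insert v D := hu' ▸ Finset.mem_insert_self _ _
        rcases (hwu u humem).1 (hD' ▸ h3) with rfl | rfl
        · exact Or.inl hD'
        · exact Or.inr hD'
      · have key : ∀ u ∈ insert v D, u = v ∨ u = w → D' = (insert v D).erase u →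
            (IsDominant r D' ∧ D'.card + 1 = Fintype.card I ∧
              D'.image c = Finset.univ.erase i₀) ∧ D' ⊆ insert v D := by
          rintro u hu huvw rfl
          refine ⟨⟨fun y => ?_, ?_, (hwu u hu).2 huvw⟩, Finset.erase_subset _ _⟩
          · obtain ⟨i, hi⟩ := hB.1 y
            exact ⟨i, fun x hx => hi x (Finset.mem_of_mem_erase hx)⟩
          · rw [Finset.card_erase_add_one hu, hB.2]
        rintro (h | h)
        · exact key v (Finset.mem_insert_self _ _) (Or.inl rfl) h
        · exact key w (Finset.mem_insert_of_mem hw) (Or.inr rfl) h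
    rw [this, Finset.card_pair]
    · exact even_two
    · intro h
      have : v ∈ (insert v D).erase w := by simp [hvw]
      rw [← h] at this
      simp at this
  have hdoor : ∀ D ∈ doors, D ≠ D₀ → Even (rooms.filter fun B => D ⊆ B).card := by
    intro D hD hne
    simp only [doors, Finset.mem_filter, Finset.mem_univ, true_and] at hD
    obtain ⟨hDd, hDc, hDi⟩ := hD
    obtain ⟨t, htD, ht⟩ : ∃ t ∈ D, t ∉ Set.range s := by
      by_contra! h
      refine hne (Finset.eq_of_subset_of_card_le (fun x hx => ?_) (by omega))
      obtain ⟨i, rfl⟩ := h x hx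
      have : i ∈ D.image c := Finset.mem_image.2 ⟨_, hx, hc i⟩
      rw [hDi] at this
      exact Finset.mem_image_of_mem _ this
    obtain ⟨x₁, x₂, h12, hx⟩ := hDd.exists_pair_insert hr hDc ⟨t, htD⟩
      fun p => ⟨s p, fun j hj => ⟨t, htD, hs' j p t hj.symm ht⟩⟩
    have := card_dominant_supersets r D
    rw [Finset.filter_filter, ← hDc, this]
    simp only [hx]
    have : (Finset.univ.filter fun x => x = x₁ ∨ x = x₂) = {x₁, x₂} := by ext; simp
    rw [this, Finset.card_pair h12]
    exact even_two
  have houter : (rooms.filter fun B => D₀ ⊆ B).card = 1 := by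
    have := card_dominant_supersets r D₀
    rw [Finset.filter_filter, ← hD₀card, this]
    obtain ⟨t, ht, htmax⟩ := (Finset.univ.filter fun x => x ∉ Set.range s).exists_max_image
      (r i₀) (by obtain ⟨t, ht⟩ := hT; exact ⟨t, by simpa using ht⟩)
    simp only [Finset.mem_filter, Finset.mem_univ, true_and] at ht htmax
    rw [Finset.card_eq_one]
    refine ⟨t, ?_⟩
    have hmemD₀ : ∀ i, i ≠ i₀ → s i ∈ D₀ := fun i hi =>
      Finset.mem_image_of_mem _ (by simp [hi])
    ext x
    simp only [Finset.mem_filter, Finset.mem_univ, true_and, Finset.mem_singleton]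
    constructor
    · rintro ⟨hx, hxd⟩
      obtain ⟨i, hi⟩ := hxd t
      have hii : i = i₀ := by
        by_contra hii
        exact absurd (hi _ (Finset.mem_insert_of_mem (hmemD₀ i hii)))
          (not_le.2 (hs i t fun h => ht ⟨i, h.symm⟩))
      subst hii
      have hxs : x ∉ Set.range s := by
        rintro ⟨j, rfl⟩
        by_cases hji : j = i
        · subst hji
          exact absurd (hi _ (Finset.mem_insert_self _ _))
            (not_le.2 (hs j t fun h => ht ⟨j, h.symm⟩))
        · exact hx (hmemD₀ j hji)
      exact hr i (le_antisymm (htmax x hxs) (hi x (Finset.mem_insert_self _ _)))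
    · rintro rfl
      refine ⟨fun h => ?_, fun y => ?_⟩
      · obtain ⟨j, -, hj⟩ := Finset.mem_image.1 h
        exact ht ⟨j, hj⟩
      · by_cases hy : y ∈ Set.range s
        · obtain ⟨j, rfl⟩ := hy
          refine ⟨j, fun z _ => ?_⟩
          by_cases hz : z = s j
          · rw [hz]
          · exact (hs j z hz).le
        · refine ⟨i₀, fun z hz => ?_⟩
          rcases Finset.mem_insert.1 hz with rfl | hz
          · exact htmax y hy
          · obtain ⟨j, hj, rfl⟩ := Finset.mem_image.1 hz
            exact (hs' i₀ j y (Finset.ne_of_mem_erase hj) hy).le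
  have hcount := Finset.sum_card_bipartiteAbove_eq_sum_card_bipartiteBelow (s := doors)
    (t := rooms) (fun D B : Finset S => D ⊆ B)
  have heven : Even (∑ B ∈ rooms, (doors.filter fun D => D ⊆ B).card) :=
    Finset.even_sum _ hroom
  have hodd : Odd (∑ D ∈ doors, (rooms.filter fun B => D ⊆ B).card) := by
    rw [← Finset.add_sum_erase _ _ hD₀, houter]
    refine Even.one_add (Finset.even_sum _ fun D hD => ?_)
    exact hdoor D (Finset.mem_of_mem_erase hD) (Finset.ne_of_mem_erase hD)
  exact (Nat.not_even_iff_odd.2 hodd) (hcount ▸ heven)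

/-- Every colouring of the lattice points of the `N`-fold dilated simplex has a cluster of
nearby points on which every colour `i` appears, unless the cluster is close to the face
`t i = 0`. -/
theorem exists_rainbow_cluster {ι : Type*} [Fintype ι] [Nonempty ι] (N : ℕ)
    (c : (ι → ℕ) → ι) :
    ∃ σ : Set (ι → ℕ), σ.Nonempty ∧ (∀ t ∈ σ, ∑ i, t i = N) ∧
      (∀ t ∈ σ, ∀ t' ∈ σ, ∀ i, t i ≤ t' i + Fintype.card ι) ∧
      ∀ i, (∃ t ∈ σ, c t = i) ∨ ∀ t ∈ σ, t i ≤ Fintype.card ι := by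
  classical
  let T : Type _ := ↥(Finset.piAntidiag (Finset.univ : Finset ι) N)
  have hTmem : ∀ t : ι → ℕ, t ∈ Finset.piAntidiag (Finset.univ : Finset ι) N ↔ ∑ i, t i = N := by
    intro t
    simp [Finset.mem_piAntidiag]
  have hTle : ∀ (t : T) i, t.1 i ≤ N := fun t i =>
    (Finset.single_le_sum (fun _ _ => Nat.zero_le _) (Finset.mem_univ i)).trans_eq
      ((hTmem t.1).1 t.2)
  let h : ι → T ⊕ ι → ℤ := fun i =>
    Sum.elim (fun t => (t.1 i : ℤ)) fun j => if j = i then -1 else N + 1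
  let r : ι → T ⊕ ι → ℤ ×ₗ Fin (Fintype.card (T ⊕ ι)) := fun i x =>
    toLex (h i x, Fintype.equivFin _ x)
  have hr : ∀ i, Function.Injective (r i) := fun i x y hxy =>
    (Fintype.equivFin _).injective (congrArg (fun p => (ofLex p).2) hxy)
  have hlt : ∀ i x y, h i x < h i y → r i x < r i y := fun i x y hxy =>
    Prod.Lex.toLex_lt_toLex.2 (Or.inl hxy)
  have hle : ∀ i x y, r i x ≤ r i y → h i x ≤ h i y := fun i x y hxy =>
    not_lt.1 fun hyx => not_lt.2 hxy (hlt i y x hyx)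
  obtain ⟨i₁⟩ := id ‹Nonempty ι›
  have hy₀ : ∑ i, (Pi.single i₁ N : ι → ℕ) i = N := by simp
  obtain ⟨B, hBd, hBc, -⟩ := exists_dominant_rainbow (c := Sum.elim (fun t : T => c t.1) id)
    hr (s := Sum.inr) (by
      rintro i (t | j) hx
      · exact hlt _ _ _ (by simp only [h, Sum.elim_inr, Sum.elim_inl, if_true]; omega)
      · have : j ≠ i := fun hj => hx (by rw [hj])
        exact hlt _ _ _ (by simp only [h, Sum.elim_inr, this, if_true, if_false]; omega))
    (by
      rintro i j (t | k) hji hx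
      · refine hlt _ _ _ ?_
        have := hTle t i
        simp only [h, Sum.elim_inr, Sum.elim_inl, hji, if_false]
        omega
      · exact absurd ⟨k, rfl⟩ hx)
    ⟨Sum.inl ⟨_, (hTmem _).2 hy₀⟩, by simp⟩ (fun i => rfl)
  let σ : Set (ι → ℕ) := {t | ∃ ht : t ∈ Finset.piAntidiag (Finset.univ : Finset ι) N,
    (Sum.inl ⟨t, ht⟩ : T ⊕ ι) ∈ B}
  let C : Finset ι := Finset.univ.filter fun i => (Sum.inr i : T ⊕ ι) ∉ B
  have hσsum : ∀ t ∈ σ, ∑ i, t i = N := fun t ht => (hTmem t).1 ht.1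
  have hdom : ∀ y : ι → ℕ, ∑ i, y i = N → ∃ i ∈ C, ∀ t ∈ σ, y i ≤ t i := by
    intro y hy
    obtain ⟨i, hi⟩ := hBd (Sum.inl ⟨y, (hTmem y).2 hy⟩)
    refine ⟨i, ?_, ?_⟩
    · simp only [C, Finset.mem_filter, Finset.mem_univ, true_and]
      intro hmem
      have := hle _ _ _ (hi _ hmem)
      simp only [h, Sum.elim_inr, Sum.elim_inl, if_true] at this
      omega
    · rintro t ⟨ht, htB⟩
      have := hle _ _ _ (hi _ htB)
      simpa [h] using this
  have hcol : ∀ i ∈ C, ∃ t ∈ σ, c t = i := by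
    intro i hi
    obtain ⟨x, hxB, hxi⟩ := Finset.mem_image.1 (hBc.symm ▸ Finset.mem_univ i)
    rcases x with ⟨t, ht⟩ | j
    · exact ⟨t, ⟨ht, hxB⟩, hxi⟩
    · obtain rfl : j = i := hxi
      simp [C, hxB] at hi
  have hσ : σ.Nonempty := by
    obtain ⟨i, hi, -⟩ := hdom _ hy₀
    obtain ⟨t, ht, -⟩ := hcol i hi
    exact ⟨t, ht⟩
  let μ : ι → ℕ := fun i => sInf ((fun t : ι → ℕ => t i) '' σ)
  have hμle : ∀ t ∈ σ, ∀ i, μ i ≤ t i := fun t ht i => Nat.sInf_le ⟨t, ht, rfl⟩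
  have hμmem : ∀ i, ∃ t ∈ σ, t i = μ i := fun i => Nat.sInf_mem (hσ.image _)
  have hμsum : N < ∑ i ∈ C, (μ i + 1) := by
    by_contra! hle
    obtain ⟨i, hi, hit⟩ := hdom
      (fun i => (if i ∈ C then μ i + 1 else 0) +
        (Pi.single i₁ (N - ∑ i ∈ C, (μ i + 1)) : ι → ℕ) i) (by
        rw [Finset.sum_add_distrib, Finset.sum_ite_mem, Finset.univ_inter]
        simp only [Finset.sum_pi_single', Finset.mem_univ, if_true]
        omega)
    obtain ⟨t, ht, hti⟩ := hμmem i
    have := hit t ht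
    simp only [hi, if_true] at this
    omega
  rw [Finset.sum_add_distrib, Finset.sum_const, smul_eq_mul, mul_one] at hμsum
  have hCcard : C.card ≤ Fintype.card ι := Finset.card_le_univ C
  have hin : ∀ i ∈ C, ∀ t ∈ σ, t i ≤ μ i + Fintype.card ι := by
    intro i hi t ht
    have h1 : ∑ j ∈ C, t j ≤ N :=
      hσsum t ht ▸ Finset.sum_le_sum_of_subset (Finset.subset_univ C)
    have h2 : ∑ j ∈ C.erase i, μ j ≤ ∑ j ∈ C.erase i, t j :=
      Finset.sum_le_sum fun j _ => hμle t ht j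
    rw [← Finset.add_sum_erase _ _ hi] at h1 hμsum
    omega
  have hout : ∀ i ∉ C, ∀ t ∈ σ, t i ≤ Fintype.card ι := by
    intro i hi t ht
    have h1 : ∑ j ∈ insert i C, t j ≤ N :=
      hσsum t ht ▸ Finset.sum_le_sum_of_subset (Finset.subset_univ _)
    have h2 : ∑ j ∈ C, μ j ≤ ∑ j ∈ C, t j := Finset.sum_le_sum fun j _ => hμle t ht j
    rw [Finset.sum_insert hi] at h1
    omega
  refine ⟨σ, hσ, hσsum, fun t ht t' ht' i => ?_, fun i => ?_⟩
  · by_cases hi : i ∈ C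
    · have := hin i hi t ht
      have := hμle t' ht' i
      omega
    · have := hout i hi t ht
      omega
  · by_cases hi : i ∈ C
    · exact Or.inl (hcol i hi)
    · exact Or.inr (hout i hi)

/-- An approximate form of Brouwer's theorem on the standard simplex. -/
theorem exists_approx_fixedPoint_stdSimplex {ι : Type*} [Fintype ι] [Nonempty ι]
    {f : (ι → ℝ) → ι → ℝ} (hf : ContinuousOn f (stdSimplex ℝ ι))
    (hmaps : Set.MapsTo f (stdSimplex ℝ ι) (stdSimplex ℝ ι)) {ε : ℝ} (hε : 0 < ε) :
    ∃ z ∈ stdSimplex ℝ ι, ∀ i, z i ≤ f z i + ε := by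
  classical
  obtain ⟨δ, hδ, hfδ⟩ := Metric.uniformContinuousOn_iff.1
    ((isCompact_stdSimplex ℝ ι).uniformContinuousOn_of_continuous hf) (ε / 2) (half_pos hε)
  obtain ⟨k, hk⟩ : ∃ k : ℝ, k = (Fintype.card ι : ℝ) := ⟨_, rfl⟩
  obtain ⟨N, hN⟩ := exists_nat_gt (k / min δ (ε / 2))
  have hmin : 0 < min δ (ε / 2) := lt_min hδ (half_pos hε)
  have hk0 : 0 ≤ k := hk ▸ Nat.cast_nonneg _
  have hN0 : (0 : ℝ) < N := (div_nonneg hk0 hmin.le).trans_lt hN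
  have hkN : k / N < min δ (ε / 2) := by
    rw [div_lt_iff₀ hmin] at hN
    rw [div_lt_iff₀ hN0]
    linarith
  let p : (ι → ℕ) → ι → ℝ := fun t i => t i / N
  have hp : ∀ t : ι → ℕ, ∑ i, t i = N → p t ∈ stdSimplex ℝ ι := by
    intro t ht
    refine ⟨fun i => by positivity, ?_⟩
    rw [← Finset.sum_div, ← Nat.cast_sum, ht, div_self hN0.ne']
  have hcol : ∀ t : ι → ℕ, ∃ i, ∑ i, t i = N → p t i ≤ f (p t) i := by
    intro t
    by_cases ht : ∑ i, t i = N
    · obtain ⟨i, -, hi⟩ := Finset.exists_le_of_sum_le (s := Finset.univ) (f := p t)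
        (g := f (p t)) Finset.univ_nonempty (by rw [(hp t ht).2, (hmaps (hp t ht)).2])
      exact ⟨i, fun _ => hi⟩
    · exact ⟨Classical.arbitrary ι, fun h => absurd h ht⟩
  choose c hc using hcol
  obtain ⟨σ, ⟨t, ht⟩, hσ, hclose, hrain⟩ := exists_rainbow_cluster N c
  refine ⟨p t, hp t (hσ t ht), fun i => ?_⟩
  have hsub : ∀ t ∈ σ, ∀ t' ∈ σ, ∀ i, p t i ≤ p t' i + k / N := by
    intro t ht t' ht' i
    have : (t i : ℝ) ≤ t' i + k := by rw [hk]; exact_mod_cast hclose t ht t' ht' i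
    simp only [p]
    rw [← add_div]
    gcongr
  have hε2 := hkN.trans_le (min_le_right _ _)
  rcases hrain i with ⟨t', ht', rfl⟩ | hi
  · have hdist : dist (p t) (p t') < δ := by
      refine (dist_pi_lt_iff hδ).2 fun j => ?_
      refine lt_of_le_of_lt ?_ (hkN.trans_le (min_le_left _ _))
      rw [Real.dist_eq, abs_le]
      constructor <;> linarith [hsub t ht t' ht' j, hsub t' ht' t ht j]
    have hfd := (dist_le_pi_dist _ _ (c t')).trans_lt
      (hfδ _ (hp t (hσ t ht)) _ (hp t' (hσ t' ht')) hdist)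
    rw [Real.dist_eq, abs_lt] at hfd
    linarith [hc t' (hσ t' ht'), hsub t ht t' ht' (c t')]
  · have h1 : p t i ≤ k / N := by
      have : (t i : ℝ) ≤ k := by rw [hk]; exact_mod_cast hi t ht
      simp only [p]
      gcongr
    linarith [(hmaps (hp t (hσ t ht))).1 i]

/-- **Brouwer's fixed point theorem** for the standard simplex. -/
theorem exists_fixedPoint_stdSimplex {ι : Type*} [Fintype ι] [Nonempty ι]
    {f : (ι → ℝ) → ι → ℝ} (hf : ContinuousOn f (stdSimplex ℝ ι))
    (hmaps : Set.MapsTo f (stdSimplex ℝ ι) (stdSimplex ℝ ι)) :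
    ∃ z ∈ stdSimplex ℝ ι, f z = z := by
  classical
  have hcont : ContinuousOn (fun z : ι → ℝ => Finset.univ.sup' Finset.univ_nonempty
      fun i => z i - f z i) (stdSimplex ℝ ι) :=
    ContinuousOn.finset_sup'_apply _ fun i _ =>
      (continuous_apply i).continuousOn.sub ((continuous_apply i).comp_continuousOn hf)
  obtain ⟨z, hz, hzmin⟩ := (isCompact_stdSimplex ℝ ι).exists_isMinOn
    (let ⟨w, hw, _⟩ := exists_approx_fixedPoint_stdSimplex hf hmaps one_pos; ⟨w, hw⟩) hcont
  have hle : ∀ i, z i ≤ f z i := by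
    intro i
    refine le_of_forall_pos_le_add fun ε hε => ?_
    obtain ⟨w, hw, hwε⟩ := exists_approx_fixedPoint_stdSimplex hf hmaps hε
    have h1 := Finset.le_sup' (fun i => z i - f z i) (Finset.mem_univ i)
    have h2 : (Finset.univ.sup' Finset.univ_nonempty fun i => w i - f w i) ≤ ε :=
      Finset.sup'_le _ _ fun j _ => by linarith [hwε j]
    have h3 := isMinOn_iff.1 hzmin w hw
    linarith
  refine ⟨z, hz, funext fun i => ?_⟩
  have hsum : ∑ i, z i = ∑ i, f z i := by rw [hz.2, (hmaps hz).2]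
  exact ((Finset.sum_eq_sum_iff_of_le fun i _ => hle i).1 hsum i (Finset.mem_univ i)).symm

/-- **Fan–Browder theorem**: a relation on a compact convex set with convex upper sections, open
lower sections and no reflexive point has a point with empty upper section. -/
theorem exists_forall_not_of_irreflexive {E : Type*} [NormedAddCommGroup E] [NormedSpace ℝ E]
    {X : Set E} (hXc : Convex ℝ X) (hXcp : IsCompact X) (hXne : X.Nonempty)
    {P : E → E → Prop} (hirr : ∀ x, ¬ P x x) (hopen : ∀ y, IsOpen {x | P y x})
    (hconv : ∀ x, Convex ℝ {y | P y x}) : ∃ x ∈ X, ∀ y ∈ X, ¬ P y x := by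
  classical
  by_contra! hno
  obtain ⟨Y, hY⟩ := hXcp.elim_finite_subcover (fun y : X => {x | P y x}) (fun y => hopen y)
    fun x hx => by
      obtain ⟨y, hy, hyx⟩ := hno x hx
      exact Set.mem_iUnion.2 ⟨⟨y, hy⟩, hyx⟩
  have hYcov : ∀ x ∈ X, ∃ i : Y, P i x := fun x hx => by
    simpa using hY hx
  obtain ⟨x₀, hx₀⟩ := hXne
  have : Nonempty Y := ⟨(hYcov x₀ hx₀).choose⟩
  let g : Y → E → ℝ := fun i x => Metric.infDist x {x | P i x}ᶜ
  have hg0 : ∀ (i : Y) x, 0 ≤ g i x := fun i x => Metric.infDist_nonneg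
  have hgpos : ∀ (i : Y) x, P i x ↔ 0 < g i x := by
    intro i x
    have := (hopen i).isClosed_compl.notMem_iff_infDist_pos ⟨(i : E), hirr i⟩ (x := x)
    simpa using this
  have hgcont : ∀ i, Continuous (g i) := fun i => Metric.continuous_infDist_pt _
  let q : (Y → ℝ) → E := fun t => ∑ i, t i • (i : E)
  have hq : Continuous q := by fun_prop
  have hqX : ∀ t ∈ stdSimplex ℝ Y, q t ∈ X := fun t ht =>
    hXc.sum_mem (fun i _ => ht.1 i) ht.2 fun i _ => i.1.2
  have hGpos : ∀ t ∈ stdSimplex ℝ Y, 0 < ∑ i, g i (q t) := by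
    intro t ht
    obtain ⟨i, hi⟩ := hYcov _ (hqX t ht)
    exact Finset.sum_pos' (fun i _ => hg0 i _) ⟨i, Finset.mem_univ _, (hgpos i _).1 hi⟩
  obtain ⟨t, ht, hfix⟩ := exists_fixedPoint_stdSimplex
    (f := fun t i => g i (q t) / ∑ j, g j (q t))
    (continuousOn_pi.2 fun i => ContinuousOn.div ((hgcont i).comp hq).continuousOn
      (continuous_finsetSum _ fun j _ => (hgcont j).comp hq).continuousOn
      fun t ht => (hGpos t ht).ne')
    (fun t ht => ⟨fun i => div_nonneg (hg0 i _) (hGpos t ht).le, by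
      rw [← Finset.sum_div, div_self (hGpos t ht).ne']⟩)
  have hpos : ∀ i : Y, t i ≠ 0 → P i (q t) := by
    intro i hi
    rw [hgpos]
    refine lt_of_le_of_ne (hg0 i _) fun h => hi ?_
    rw [← hfix]
    simp [← h]
  refine hirr (q t) ?_
  have hmem : ∑ i ∈ Finset.univ.filter (fun i => t i ≠ 0), t i • (i : E) ∈ {y | P y (q t)} :=
    (hconv (q t)).sum_mem (fun i _ => ht.1 i) (by rw [Finset.sum_filter_ne_zero]; exact ht.2)
      fun i hi => hpos i (Finset.mem_filter.1 hi).2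
  rwa [Finset.sum_filter_of_ne fun i _ h => (smul_ne_zero_iff.1 h).1] at hmem

/-- Let `n ≥ 1`, `X ⊆ ℝ^n` convex, compact and non-empty, and `R` a binary
relation on `ℝ^n`.  If `R` is continuous (upper and lower semicontinuous) and convexˢ, then
there exists at least one maximal element of `R` on `X`. -/
theorem stmt_11 {n : ℕ} (hn : 1 ≤ n) (X : Set (Euc n))
    (hXc : Convex ℝ X) (hXcp : IsCompact X) (hXne : X.Nonempty)
    (R : Euc n → Euc n → Prop)
    (husc : ∀ x : Euc n, IsOpen (Ls R x))
    (hlsc : ∀ x : Euc n, IsOpen (Us R x))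
    (hconv : ∀ x : Euc n, Convex ℝ (Us R x)) :
    ∃ xhat ∈ X, Us R xhat ∩ X = ∅ := by
  obtain ⟨x, hx, hmax⟩ := exists_forall_not_of_irreflexive hXc hXcp hXne (P := SP R)
    (fun x h => h.2 h.1) husc hconv
  exact ⟨x, hx, Set.eq_empty_iff_forall_notMem.2 fun y hy => hmax y hy.2 hy.1⟩
end
end

section
/- Let ≽ be a binary relation on ℝ^n. If the set ME(ℝ^n) of maximal elements of ℝ^n and the solution set MVIP(N, ℝ^n) of the Minty variational inequality problem for N are both non-empty, then there exists x̂ ∈ ℝ^n such that ME(ℝ^n) = MVIP(N, ℝ^n) = {x̂}. -/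
open RealInnerProductSpace

noncomputable section

/-- The set of maximal elements of `ℝ^n`: those `x` with `Uˢ(x) = ∅`. -/
def ME {n : ℕ} (R : Euc n → Euc n → Prop) : Set (Euc n) := {x | Us R x = ∅}

/-- The solution set of the Minty variational inequality problem for `N` on `ℝ^n`. -/
def MVIP {n : ℕ} (R : Euc n → Euc n → Prop) : Set (Euc n) :=
  {x | ∀ y : Euc n, ∀ ys ∈ N R y, ⟪ys, x - y⟫ ≤ 0}

/-- Every Minty solution coincides with every maximal element, since the normal cone at a
maximal element is the whole space. -/
theorem eq_of_mem_MVIP_of_mem_ME {n : ℕ} {R : Euc n → Euc n → Prop} {x y : Euc n}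
    (hx : x ∈ MVIP R) (hy : y ∈ ME R) : x = y := by
  have hN : x - y ∈ N R y := by
    intro z hz
    rw [show Us R y = ∅ from hy] at hz
    exact hz.elim
  exact sub_eq_zero.mp (real_inner_self_nonpos.mp (hx y (x - y) hN))

/-- If the set `ME(ℝ^n)` of maximal elements and the Minty solution set
`MVIP(N, ℝ^n)` are both non-empty, then both coincide with a common singleton `{x̂}`. -/
theorem stmt_13 {n : ℕ} (R : Euc n → Euc n → Prop)
    (hME : (ME R).Nonempty) (hMVIP : (MVIP R).Nonempty) :
    ∃ xhat : Euc n, ME R = {xhat} ∧ MVIP R = {xhat} := by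
  obtain ⟨m, hm⟩ := hME
  obtain ⟨x, hx⟩ := hMVIP
  obtain rfl := eq_of_mem_MVIP_of_mem_ME hx hm
  exact ⟨x, Set.eq_singleton_iff_unique_mem.mpr
      ⟨hm, fun _ hy => (eq_of_mem_MVIP_of_mem_ME hx hy).symm⟩,
    Set.eq_singleton_iff_unique_mem.mpr ⟨hx, fun _ hy => eq_of_mem_MVIP_of_mem_ME hy hm⟩⟩
end
end

section
/- Let ≽ be an upper semicontinuous binary relation on ℝ^n and f : ℝ^n × ℝ^n → ℝ a function. If f is upper semicontinuous, then the Plastria-like normal cone correspondence N_f is closed, i.e. its graph {(x, x*) ∈ ℝ^n × ℝ^n : x* ∈ N_f(x)} is a closed subset of ℝ^n × ℝ^n. -/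
open RealInnerProductSpace

noncomputable section

/-- The Plastria-like normal cone `N_f(x)` of `R` with respect to `f`.  Note that when
`Uˢ(x) = ∅` this set is (vacuously) all of `ℝ^n`, as in the definition of the paper. -/
def Nf {n : ℕ} (R : Euc n → Euc n → Prop) (f : Euc n → Euc n → ℝ) (x : Euc n) :
    Set (Euc n) :=
  {p | ∀ y ∈ Us R x, ⟪p, y - x⟫ ≤ f x y}

/-- Let `R` be upper semicontinuous and `f : ℝ^n × ℝ^n → ℝ` upper
semicontinuous.  Then the Plastria-like normal cone correspondence `N_f` is closed:
its graph is a closed subset of `ℝ^n × ℝ^n`. -/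
theorem stmt_15 {n : ℕ} (R : Euc n → Euc n → Prop)
    (husc : ∀ x : Euc n, IsOpen (Ls R x))
    (f : Euc n → Euc n → ℝ)
    (hf : UpperSemicontinuous fun p : Euc n × Euc n => f p.1 p.2) :
    IsClosed {p : Euc n × Euc n | p.2 ∈ Nf R f p.1} := by
  rw [← isOpen_compl_iff, isOpen_iff_mem_nhds]
  rintro ⟨x, p⟩ hp
  simp only [Set.mem_compl_iff, Set.mem_ofPred_eq, Nf, not_forall, not_le] at hp
  obtain ⟨y, hy, hlt⟩ := hp
  obtain ⟨c, hfc, hcp⟩ := exists_between hlt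
  have hU : ∀ᶠ q : Euc n × Euc n in nhds (x, p), y ∈ Us R q.1 :=
    ((husc y).preimage continuous_fst).mem_nhds hy
  have hF : ∀ᶠ q : Euc n × Euc n in nhds (x, p), f q.1 y < c :=
    (hf.comp (g := fun q : Euc n × Euc n => (q.1, y)) (by fun_prop)) (x, p) c hfc
  have hI : ∀ᶠ q : Euc n × Euc n in nhds (x, p), c < ⟪q.2, y - q.1⟫ :=
    (show Continuous fun q : Euc n × Euc n => ⟪q.2, y - q.1⟫ by
      fun_prop).continuousAt.eventually_const_lt hcp
  filter_upwards [hU, hF, hI] with q hqU hqF hqI hq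
  exact (hqF.trans hqI).not_ge (hq y hqU)
end
end

section
/- Let ≽ be a binary relation on ℝ^n and f : ℝ^n × ℝ^n → ℝ a function such that f(x, y) < 0 if, and only if, y ∈ Uˢ(x), and such that for every y ∈ ℝ^n the function x ↦ f(x, y) is upper semicontinuous. If (x₀, 0) belongs to the closure of the graph of N_f, then 0 ∈ N_f(x₀). -/
open RealInnerProductSpace

noncomputable section

/-- Let `R` and `f` satisfy `f(x, y) < 0 ↔ y ∈ Uˢ(x)`, with
`x ↦ f(x, y)` upper semicontinuous for every `y`.  If `(x₀, 0)` belongs to the closure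
of the graph of `N_f`, then `0 ∈ N_f(x₀)`. -/
theorem stmt_17 {n : ℕ} (R : Euc n → Euc n → Prop)
    (f : Euc n → Euc n → ℝ)
    (hf : ∀ x y : Euc n, f x y < 0 ↔ y ∈ Us R x)
    (husc : ∀ y : Euc n, UpperSemicontinuous fun x => f x y)
    (x₀ : Euc n)
    (hx₀ : (x₀, (0 : Euc n)) ∈ closure {p : Euc n × Euc n | p.2 ∈ Nf R f p.1}) :
    (0 : Euc n) ∈ Nf R f x₀ := by
  intro y hy
  have hneg : f x₀ y < 0 := (hf x₀ y).2 hy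
  have hf_near : ∀ᶠ p : Euc n × Euc n in nhds (x₀, 0), f p.1 y < f x₀ y / 2 :=
    (continuous_fst.tendsto (x₀, (0 : Euc n))).eventually
      (husc y x₀ (f x₀ y / 2) (by linarith))
  have hinner_near : ∀ᶠ p : Euc n × Euc n in nhds (x₀, 0), f x₀ y / 2 < ⟪p.2, y - p.1⟫ := by
    have hcont : Continuous fun p : Euc n × Euc n => ⟪p.2, y - p.1⟫ := by fun_prop
    refine hcont.continuousAt.eventually (lt_mem_nhds ?_)
    simp only [inner_zero_left]
    linarith
  obtain ⟨p, hp, hfp, hip⟩ :=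
    ((mem_closure_iff_frequently.1 hx₀).and_eventually (hf_near.and hinner_near)).exists
  have hle := hp y ((hf p.1 y).1 (by linarith))
  linarith
end
end

section
/- Let ≽ be a binary relation on ℝ^n and f : ℝ^n × ℝ^n → ℝ a function such that: (1) for all x, y ∈ ℝ^n, if f(x, z) > f(y, z) for some z ∈ ℝ^n, then x ≻ y; and (2) there exists L > 0 such that |f(x, y)| ≤ L‖x − y‖ for all x, y ∈ ℝ^n. Then for every x₀ ∈ ℝ^n and every nonzero u* ∈ N*(x₀), the vector x₀* = (L/‖u*‖)·u* belongs to N_f(x₀). -/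
open RealInnerProductSpace

noncomputable section

/-- Suppose (1) `f(x, z) > f(y, z)` for some `z` implies `x ≻ y`, and
(2) `|f(x, y)| ≤ L‖x − y‖` for some `L > 0` and all `x, y`.  Then for every `x₀` and every
nonzero `u* ∈ N*(x₀)`, the vector `(L/‖u*‖) • u*` belongs to `N_f(x₀)`. -/
theorem stmt_18 {n : ℕ} (R : Euc n → Euc n → Prop)
    (f : Euc n → Euc n → ℝ) (L : ℝ) (hL : 0 < L)
    (h1 : ∀ x y : Euc n, (∃ z : Euc n, f y z < f x z) → SP R x y)
    (h2 : ∀ x y : Euc n, |f x y| ≤ L * ‖x - y‖) :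
    ∀ x₀ : Euc n, ∀ us ∈ Nstar R x₀, us ≠ 0 →
      (L / ‖us‖) • us ∈ Nf R f x₀ := by
  intro x₀ us hus hne y hy
  have hpos : 0 < ‖us‖ := norm_pos_iff.mpr hne
  have ht : ⟪us, y - x₀⟫ < 0 := hus y hy
  -- `z` is the orthogonal projection of `y` onto the hyperplane through `x₀` normal to `us`
  set z : Euc n := y - (⟪us, y - x₀⟫ / ‖us‖ ^ 2) • us with hz
  have hzorth : ⟪us, z - x₀⟫ = 0 := by
    rw [hz, sub_right_comm, inner_sub_right, inner_smul_right, real_inner_self_eq_norm_sq]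
    field_simp
    ring
  have hzU : ¬ SP R z x₀ := fun h => (hus z h).ne hzorth
  have hle : f z y ≤ f x₀ y := not_lt.mp fun h => hzU (h1 z x₀ ⟨y, h⟩)
  have hnorm : ‖z - y‖ = -⟪us, y - x₀⟫ / ‖us‖ := by
    rw [hz, sub_sub_cancel_left, norm_neg, norm_smul, Real.norm_eq_abs, abs_div, abs_of_neg ht,
      abs_of_nonneg (sq_nonneg ‖us‖)]
    field_simp
  have hlow : -(L * ‖z - y‖) ≤ f z y := (abs_le.mp (h2 z y)).1
  calc ⟪(L / ‖us‖) • us, y - x₀⟫ = -(L * ‖z - y‖) := by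
        rw [real_inner_smul_left, hnorm]
        ring
    _ ≤ f x₀ y := hlow.trans hle
end
end
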